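/- Let k ≥ 1 and let M be a feasible schedule over [0,T] from a feasible configuration A of k unit-square robots to a feasible configuration B, with every trajectory continuous. Then there exist T' ≤ T and a feasible schedule M' over [0,T'] from A to B, with continuous trajectories, such that for every ordering σ (a choice, for each unordered pair {i,j} with i ≠ j, of one of the four relations x(p_i) ≥ x(p_j)+1, x(p_j) ≥ x(p_i)+1, y(p_i) ≥ y(p_j)+1, y(p_j) ≥ y(p_i)+1), the set of times {t ∈ [0,T'] : the configuration M'(t) satisfies all relations chosen by σ} is order-connected; that is, M' never exits and later re-enters an ordering, and its makespan is no larger than that of M. -/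

import Mathlib

/-- The L1 norm of a point of the plane. -/
noncomputable def l1 (p : ℝ × ℝ) : ℝ := |p.1| + |p.2|

/-- A configuration of `k` unit-square robots is feasible if all robots are pairwise
interior disjoint. -/
def FeasibleConfig {k : ℕ} (P : Fin k → ℝ × ℝ) : Prop :=
  ∀ i j : Fin k, i ≠ j → max |(P i).1 - (P j).1| |(P i).2 - (P j).2| ≥ 1

/-- `m` is a feasible schedule from configuration `A` to configuration `B` over `[0,T]`. -/
def IsScheduleK {k : ℕ} (m : Fin k → ℝ → ℝ × ℝ) (A B : Fin k → ℝ × ℝ) (T : ℝ) : Prop :=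
  0 ≤ T ∧ (∀ i, m i 0 = A i) ∧ (∀ i, m i T = B i) ∧
  (∀ i, ∀ s ∈ Set.Icc (0:ℝ) T, ∀ t ∈ Set.Icc (0:ℝ) T, l1 (m i s - m i t) ≤ |s - t|) ∧
  (∀ t ∈ Set.Icc (0:ℝ) T, FeasibleConfig (fun i => m i t))

/-- A configuration `P` is in the ordering `σ`, where `σ` chooses, for each unordered
pair `{i, j}` of distinct robots (represented by `i < j`), one of the four axis-parallel
separation relations. -/
def InOrdering {k : ℕ} (σ : Fin k → Fin k → Fin 4) (P : Fin k → ℝ × ℝ) : Prop :=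
  ∀ i j : Fin k, i < j →
    (σ i j = 0 → (P i).1 ≥ (P j).1 + 1) ∧
    (σ i j = 1 → (P j).1 ≥ (P i).1 + 1) ∧
    (σ i j = 2 → (P i).2 ≥ (P j).2 + 1) ∧
    (σ i j = 3 → (P j).2 ≥ (P i).2 + 1)

open Set Filter Topology

/-- The Euclidean space containing all configurations of `k` robots. -/
abbrev ConfE (k : ℕ) := EuclideanSpace ℝ (Fin k × Fin 2)

/-- Position of robot `i`. -/
def pt {k : ℕ} (v : ConfE k) (i : Fin k) : ℝ × ℝ := (v (i, 0), v (i, 1))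

/-- Replace `f` by a straight segment on `[s,t]`. -/
noncomputable def splice {E : Type*} [NormedAddCommGroup E] [NormedSpace ℝ E]
    (f : ℝ → E) (s t : ℝ) (r : ℝ) : E :=
  open Classical in
  if r ∈ Icc s t then AffineMap.lineMap (f s) (f t) ((r - s) / (t - s)) else f r

section splice

variable {E : Type*} [NormedAddCommGroup E] [NormedSpace ℝ E] {f : ℝ → E} {s t : ℝ}

lemma splice_in {r : ℝ} (hr : r ∈ Icc s t) :
    splice f s t r = AffineMap.lineMap (f s) (f t) ((r - s) / (t - s)) := by
  simp only [splice, if_pos hr]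

lemma splice_left (hst : s < t) {r : ℝ} (hr : r ≤ s) : splice f s t r = f r := by
  rcases hr.lt_or_eq with h | h
  · have : r ∉ Icc s t := fun h' => absurd h'.1 (not_le.2 h)
    simp only [splice, if_neg this]
  · subst h
    rw [splice_in ⟨le_rfl, hst.le⟩]
    simp

lemma splice_right (hst : s < t) {r : ℝ} (hr : t ≤ r) : splice f s t r = f r := by
  rcases hr.lt_or_eq with h | h
  · have : r ∉ Icc s t := fun h' => absurd h'.2 (not_le.2 h)
    simp only [splice, if_neg this]
  · subst h
    rw [splice_in ⟨hst.le, le_rfl⟩]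
    have : t - s ≠ 0 := by linarith
    simp [div_self this]

lemma frac_mem (hst : s < t) {r : ℝ} (hr : r ∈ Icc s t) : (r - s) / (t - s) ∈ Icc (0:ℝ) 1 := by
  have : 0 < t - s := by linarith
  constructor
  · exact div_nonneg (by linarith [hr.1]) this.le
  · rw [div_le_one this]; linarith [hr.2]

lemma variation_splice_le (hst : s < t) :
    eVariationOn (splice f s t) (Icc s t) ≤ edist (f s) (f t) := by
  have h1 : EqOn (splice f s t)
      ((AffineMap.lineMap (f s) (f t) : ℝ → E) ∘ (fun r => (r - s) / (t - s))) (Icc s t) :=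
    fun r hr => splice_in hr
  rw [eVariationOn.eq_of_eqOn h1]
  have h2 := ((lipschitzWith_lineMap (𝕜 := ℝ) (f s) (f t)).lipschitzOnWith
    (s := univ)).comp_eVariationOn_le (g := fun r : ℝ => (r - s) / (t - s)) (s := Icc s t)
      (mapsTo_univ _ _)
  refine h2.trans ?_
  have hm : MonotoneOn (fun r : ℝ => (r - s) / (t - s)) (Icc s t) := by
    intro a _ b _ hab
    have : 0 < t - s := by linarith
    show (a - s) / (t - s) ≤ (b - s) / (t - s)
    gcongr
  have h3 := hm.eVariationOn_le (a := s) (b := t) ⟨le_rfl, hst.le⟩ ⟨hst.le, le_rfl⟩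
  rw [inter_self] at h3
  have : t - s ≠ 0 := by linarith
  simp only [div_self this, sub_self, zero_div, sub_zero, ENNReal.ofReal_one] at h3
  calc _ ≤ (nndist (f s) (f t) : ENNReal) * 1 := by gcongr
    _ = _ := by rw [mul_one, edist_nndist]

lemma variation_split (g : ℝ → E) {a b c : ℝ} (hab : a ≤ b) (hbc : b ≤ c) :
    eVariationOn g (Icc a c) = eVariationOn g (Icc a b) + eVariationOn g (Icc b c) := by
  simpa using (eVariationOn.Icc_add_Icc g (s := univ) hab hbc (mem_univ b)).symm

lemma mem_segment_of_min [StrictConvexSpace ℝ E] {T u : ℝ} (h0 : 0 ≤ s) (hst : s < t) (hT : t ≤ T)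
    (hu : u ∈ Icc s t) (hfin : eVariationOn f (Icc 0 T) ≠ ⊤)
    (hmin : eVariationOn f (Icc 0 T) ≤ eVariationOn (splice f s t) (Icc 0 T)) :
    Wbtw ℝ (f s) (f u) (f t) := by
  have e1 : eVariationOn (splice f s t) (Icc 0 s) = eVariationOn f (Icc 0 s) :=
    eVariationOn.eq_of_eqOn fun r hr => splice_left hst hr.2
  have e2 : eVariationOn (splice f s t) (Icc t T) = eVariationOn f (Icc t T) :=
    eVariationOn.eq_of_eqOn fun r hr => splice_right hst hr.1
  have hs1 := variation_split (splice f s t) h0 (hst.le.trans hT)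
  have hs2 := variation_split (splice f s t) hst.le hT
  have hf1 := variation_split f h0 (hst.le.trans hT)
  have hf2 := variation_split f hst.le hT
  have hf3 := variation_split f hu.1 hu.2
  have d1 : edist (f s) (f u) ≤ eVariationOn f (Icc s u) :=
    eVariationOn.edist_le f ⟨le_rfl, hu.1⟩ ⟨hu.1, le_rfl⟩
  have d2 : edist (f u) (f t) ≤ eVariationOn f (Icc u t) :=
    eVariationOn.edist_le f ⟨le_rfl, hu.2⟩ ⟨hu.2, le_rfl⟩
  have d3 := variation_splice_le (f := f) hst
  rw [hs1, hs2, e1, e2, hf1, hf2] at hmin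
  rw [hf1, hf2] at hfin
  have n1 : eVariationOn f (Icc 0 s) ≠ ⊤ := fun h => hfin (by simp [h])
  have n2 : eVariationOn f (Icc t T) ≠ ⊤ := fun h => hfin (by simp [h])
  have h4 := (ENNReal.add_le_add_iff_right n2).1 ((ENNReal.add_le_add_iff_left n1).1 hmin)
  have h5 : edist (f s) (f u) + edist (f u) (f t) ≤ edist (f s) (f t) :=
    calc _ ≤ _ := add_le_add d1 d2
      _ = eVariationOn f (Icc s t) := hf3.symm
      _ ≤ _ := h4.trans d3
  rw [edist_dist, edist_dist, edist_dist, ← ENNReal.ofReal_add dist_nonneg dist_nonneg,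
    ENNReal.ofReal_le_ofReal_iff dist_nonneg] at h5
  exact dist_add_dist_eq_iff.1 (le_antisymm h5 (dist_triangle _ _ _))

end splice

lemma l1_triangle (p q r : ℝ × ℝ) : l1 (p - r) ≤ l1 (p - q) + l1 (q - r) := by
  simp only [l1, Prod.fst_sub, Prod.snd_sub]
  have := abs_sub_le p.1 q.1 r.1
  have := abs_sub_le p.2 q.2 r.2
  linarith

lemma l1_symm (p q : ℝ × ℝ) : l1 (p - q) = l1 (q - p) := by
  simp only [l1, Prod.fst_sub, Prod.snd_sub, abs_sub_comm]

lemma pt_lineMap {k : ℕ} (v w : ConfE k) (c : ℝ) (i : Fin k) :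
    pt (AffineMap.lineMap v w c) i =
      ((1 - c) * (pt v i).1 + c * (pt w i).1, (1 - c) * (pt v i).2 + c * (pt w i).2) := by
  ext <;> simp [pt, AffineMap.lineMap_apply] <;> ring

lemma ord_convex {k : ℕ} {σ : Fin k → Fin k → Fin 4} {v w : ConfE k}
    (hv : InOrdering σ (pt v)) (hw : InOrdering σ (pt w)) {c : ℝ} (hc : c ∈ Icc (0:ℝ) 1) :
    InOrdering σ (pt (AffineMap.lineMap v w c)) := by
  intro i j hij
  obtain ⟨a0, a1, a2, a3⟩ := hv i j hij
  obtain ⟨b0, b1, b2, b3⟩ := hw i j hij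
  have h0 := hc.1
  have h1 : 0 ≤ 1 - c := sub_nonneg.2 hc.2
  simp only [pt_lineMap]
  refine ⟨fun h => ?_, fun h => ?_, fun h => ?_, fun h => ?_⟩
  · nlinarith [mul_le_mul_of_nonneg_left (a0 h) h1, mul_le_mul_of_nonneg_left (b0 h) h0]
  · nlinarith [mul_le_mul_of_nonneg_left (a1 h) h1, mul_le_mul_of_nonneg_left (b1 h) h0]
  · nlinarith [mul_le_mul_of_nonneg_left (a2 h) h1, mul_le_mul_of_nonneg_left (b2 h) h0]
  · nlinarith [mul_le_mul_of_nonneg_left (a3 h) h1, mul_le_mul_of_nonneg_left (b3 h) h0]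

lemma ord_feasible {k : ℕ} {σ : Fin k → Fin k → Fin 4} {P : Fin k → ℝ × ℝ}
    (h : InOrdering σ P) : FeasibleConfig P := by
  have key : ∀ i j : Fin k, i < j → max |(P i).1 - (P j).1| |(P i).2 - (P j).2| ≥ 1 := by
    intro i j hij
    obtain ⟨a0, a1, a2, a3⟩ := h i j hij
    have : σ i j = 0 ∨ σ i j = 1 ∨ σ i j = 2 ∨ σ i j = 3 := by
      generalize σ i j = x
      fin_cases x <;> simp
    rcases this with h | h | h | h
    · exact le_max_of_le_left (le_abs.2 (Or.inl (by linarith [a0 h])))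
    · exact le_max_of_le_left (le_abs.2 (Or.inr (by linarith [a1 h])))
    · exact le_max_of_le_right (le_abs.2 (Or.inl (by linarith [a2 h])))
    · exact le_max_of_le_right (le_abs.2 (Or.inr (by linarith [a3 h])))
  intro i j hij
  rcases lt_or_gt_of_ne hij with h' | h'
  · exact key i j h'
  · have := key j i h'
    rwa [abs_sub_comm (P j).1, abs_sub_comm (P j).2] at this

/-- The set of bounded schedules, as trajectories in the configuration space. -/
def SchedSet {k : ℕ} (A B : Fin k → ℝ × ℝ) (T R : ℝ) : Set (ℝ → ConfE k) :=
  {f | (∀ t, f t ∈ Metric.closedBall 0 R) ∧ IsScheduleK (fun i t => pt (f t) i) A B T}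

lemma continuous_pt {k : ℕ} (t : ℝ) (i : Fin k) :
    Continuous (fun f : ℝ → ConfE k => pt (f t) i) := by
  unfold pt
  fun_prop

lemma schedSet_compact {k : ℕ} (A B : Fin k → ℝ × ℝ) (T R : ℝ) (hT : 0 ≤ T) :
    IsCompact (SchedSet A B T R) := by
  have h1 : IsCompact (univ.pi fun _ : ℝ => Metric.closedBall (0 : ConfE k) R) :=
    isCompact_univ_pi fun _ => isCompact_closedBall _ _
  have hl : Continuous l1 := by unfold l1; fun_prop
  have h2 : IsClosed {f : ℝ → ConfE k | IsScheduleK (fun i t => pt (f t) i) A B T} := by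
    simp only [IsScheduleK, FeasibleConfig, hT, true_and, setOf_and, setOf_forall]
    refine IsClosed.inter ?_ (IsClosed.inter ?_ (IsClosed.inter ?_ ?_))
    · exact isClosed_iInter fun i => isClosed_eq (continuous_pt _ _) continuous_const
    · exact isClosed_iInter fun i => isClosed_eq (continuous_pt _ _) continuous_const
    · refine isClosed_iInter fun i => isClosed_iInter fun s => isClosed_iInter fun _ =>
        isClosed_iInter fun t => isClosed_iInter fun _ => isClosed_le ?_ continuous_const
      exact hl.comp ((continuous_pt _ _).sub (continuous_pt _ _))
    · refine isClosed_iInter fun t => isClosed_iInter fun _ => isClosed_iInter fun i =>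
        isClosed_iInter fun j => isClosed_iInter fun _ => isClosed_le continuous_const ?_
      have a := continuous_pt t i
      have b := continuous_pt t j
      exact ((a.fst.sub b.fst).abs).max ((a.snd.sub b.snd).abs)
  have : SchedSet A B T R = (univ.pi fun _ : ℝ => Metric.closedBall (0 : ConfE k) R) ∩
      {f : ℝ → ConfE k | IsScheduleK (fun i t => pt (f t) i) A B T} := by
    ext f; simp [SchedSet]
  rw [this]
  exact h1.inter_right h2

lemma variation_lsc {E : Type*} [NormedAddCommGroup E] (S : Set ℝ) :
    LowerSemicontinuous (fun f : ℝ → E => eVariationOn f S) := by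
  intro f v hv
  exact eVariationOn.lowerSemicontinuous_aux (F := fun g : ℝ → E => g) (p := 𝓝 f)
    (fun x _ => (continuous_apply x).tendsto f) hv

lemma sched_finite {k : ℕ} {A B : Fin k → ℝ × ℝ} {T : ℝ} {f : ℝ → ConfE k}
    (hf : IsScheduleK (fun i t => pt (f t) i) A B T) : eVariationOn f (Icc 0 T) ≠ ⊤ := by
  obtain ⟨hT, -, -, hL, -⟩ := hf
  have h1 : LipschitzOnWith 1 (fun t => WithLp.ofLp (f t)) (Icc 0 T) := by
    refine LipschitzOnWith.of_dist_le_mul fun s hs t ht => ?_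
    rw [NNReal.coe_one, one_mul, dist_pi_le_iff dist_nonneg]
    rintro ⟨i, c⟩
    have := hL i s hs t ht
    simp only [l1, pt, Prod.fst_sub, Prod.snd_sub] at this
    rw [Real.dist_eq, Real.dist_eq]
    have a := abs_nonneg (f s (i, 0) - f t (i, 0))
    have b := abs_nonneg (f s (i, 1) - f t (i, 1))
    fin_cases c
    · show |f s (i, 0) - f t (i, 0)| ≤ _
      linarith
    · show |f s (i, 1) - f t (i, 1)| ≤ _
      linarith
  have h2 := (PiLp.lipschitzWith_toLp 2 (fun _ : Fin k × Fin 2 => ℝ)).comp_lipschitzOnWith h1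
  have h3 : LipschitzOnWith _ f (Icc 0 T) := h2
  have h4 := h3.locallyBoundedVariationOn 0 T ⟨le_rfl, hT⟩ ⟨hT, le_rfl⟩
  rw [inter_self] at h4
  exact h4

lemma splice_mem {k : ℕ} {A B : Fin k → ℝ × ℝ} {T R : ℝ} {f : ℝ → ConfE k}
    (hf : f ∈ SchedSet A B T R) {σ : Fin k → Fin k → Fin 4} {s t : ℝ}
    (h0 : 0 ≤ s) (hst : s < t) (htT : t ≤ T)
    (hs : InOrdering σ (pt (f s))) (ht : InOrdering σ (pt (f t))) :
    splice f s t ∈ SchedSet A B T R := by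
  obtain ⟨hR, hT, hA, hB, hL, hF⟩ := hf
  have hsT : s ∈ Icc 0 T := ⟨h0, hst.le.trans htT⟩
  have htT' : t ∈ Icc 0 T := ⟨h0.trans hst.le, htT⟩
  refine ⟨fun r => ?_, hT, fun i => ?_, fun i => ?_, fun i => ?_, fun r hr => ?_⟩
  · by_cases hr : r ∈ Icc s t
    · rw [splice_in hr]
      exact (convex_closedBall (0 : ConfE k) R).lineMap_mem (hR s) (hR t) (frac_mem hst hr)
    · simp only [splice, if_neg hr]
      exact hR r
  · simp only [splice_left hst h0]; exact hA i
  · simp only [splice_right hst htT]; exact hB i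
  · have hmid : ∀ a ∈ Icc s t, ∀ b ∈ Icc s t,
        l1 (pt (splice f s t a) i - pt (splice f s t b) i) ≤ |a - b| := by
      intro a ha b hb
      have hd : 0 < t - s := by linarith
      have hst' := hL i s hsT t htT'
      rw [splice_in ha, splice_in hb, pt_lineMap, pt_lineMap]
      have e : (a - b) / (t - s) = (a - s) / (t - s) - (b - s) / (t - s) := by ring
      have e2 : |a - b| = |(a - b) / (t - s)| * |s - t| := by
        rw [abs_sub_comm s t, ← abs_mul, div_mul_cancel₀ _ hd.ne']
      rw [e2, e]
      generalize (a - s) / (t - s) = c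
      generalize (b - s) / (t - s) = d
      refine le_trans (le_of_eq ?_) (mul_le_mul_of_nonneg_left hst' (abs_nonneg (c - d)))
      simp only [l1, Prod.fst_sub, Prod.snd_sub]
      rw [mul_add, ← abs_mul, ← abs_mul]
      congr 1 <;> rw [← abs_neg] <;> congr 1 <;> ring
    have hle : ∀ a ∈ Icc 0 T, ∀ b ∈ Icc 0 T, a ≤ b →
        l1 (pt (splice f s t a) i - pt (splice f s t b) i) ≤ |a - b| := by
      intro a ha b hb hab
      have hss : s ∈ Icc s t := ⟨le_rfl, hst.le⟩
      have htt : t ∈ Icc s t := ⟨hst.le, le_rfl⟩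
      have es : splice f s t s = f s := splice_left hst le_rfl
      have et : splice f s t t = f t := splice_right hst le_rfl
      have hleft : ∀ b ∈ Icc 0 T, s ≤ b → l1 (pt (f s) i - pt (splice f s t b) i) ≤ b - s := by
        intro b hb hsb
        rcases le_total b t with h | h
        · have := hmid s hss b ⟨hsb, h⟩
          rw [es, abs_of_nonpos (by linarith)] at this
          linarith
        · have h3 := hL i s hsT b hb
          rw [splice_right hst h]
          simp only at h3
          rw [abs_of_nonpos (by linarith)] at h3
          linarith
      rw [abs_of_nonpos (by linarith)]
      rcases le_total a s with h1 | h1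
      · rw [splice_left hst h1]
        rcases le_total b s with h2 | h2
        · rw [splice_left hst h2]
          have h3 := hL i a ha b hb
          simp only at h3
          rw [abs_of_nonpos (by linarith)] at h3
          exact h3
        · have h3 := hL i a ha s hsT
          simp only at h3
          rw [abs_of_nonpos (by linarith)] at h3
          have := hleft b hb h2
          have := l1_triangle (pt (f a) i) (pt (f s) i) (pt (splice f s t b) i)
          linarith
      · rcases le_total t a with h2 | h2
        · rw [splice_right hst h2, splice_right hst (h2.trans hab)]
          have h3 := hL i a ha b hb
          simp only at h3
          rw [abs_of_nonpos (by linarith)] at h3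
          exact h3
        · rcases le_total b t with h3 | h3
          · have := hmid a ⟨h1, h2⟩ b ⟨h1.trans hab, h3⟩
            rwa [abs_of_nonpos (by linarith)] at this
          · have h4 := hmid a ⟨h1, h2⟩ t htt
            rw [et, abs_of_nonpos (by linarith)] at h4
            have h5 := hL i t htT' b hb
            simp only at h5
            rw [abs_of_nonpos (by linarith)] at h5
            rw [splice_right hst h3]
            have := l1_triangle (pt (splice f s t a) i) (pt (f t) i) (pt (f b) i)
            linarith
    intro a ha b hb
    rcases le_total a b with h | h
    · exact hle a ha b hb h
    · have := hle b hb a ha h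
      rwa [l1_symm, abs_sub_comm] at this
  · by_cases hr' : r ∈ Icc s t
    · simp only [splice_in hr']
      exact ord_feasible (ord_convex hs ht (frac_mem hst hr'))
    · simp only [splice, if_neg hr']
      exact hF r hr

theorem stmt14 (k : ℕ) (hk : 1 ≤ k) (A B : Fin k → ℝ × ℝ) (T : ℝ)
    (m : Fin k → ℝ → ℝ × ℝ) (hsch : IsScheduleK m A B T)
    (hc : ∀ i, ContinuousOn (m i) (Set.Icc 0 T)) :
    ∃ T' ≤ T, ∃ m' : Fin k → ℝ → ℝ × ℝ,
      IsScheduleK m' A B T' ∧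
      (∀ i, ContinuousOn (m' i) (Set.Icc 0 T')) ∧
      ∀ σ : Fin k → Fin k → Fin 4,
        ({t ∈ Set.Icc (0:ℝ) T' | InOrdering σ (fun i => m' i t)}).OrdConnected := by
  obtain ⟨hT, hA, hB, hL, hF⟩ := hsch
  classical
  let q : ℝ → ConfE k := fun t => WithLp.toLp 2 (fun c => if c.2 = 0 then (m c.1 t).1 else (m c.1 t).2)
  have hq : ∀ i t, pt (q t) i = m i t := by
    intro i t
    simp [pt, q]
  have hqc : ContinuousOn q (Icc 0 T) := by
    refine (PiLp.continuous_toLp 2 _).comp_continuousOn (continuousOn_pi.2 fun c => ?_)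
    by_cases h : c.2 = 0
    · simp only [h, if_true]; exact (hc c.1).fst
    · simp only [h, if_false]; exact (hc c.1).snd
  obtain ⟨R, hR⟩ := (isCompact_Icc.image_of_continuousOn hqc).isBounded.subset_closedBall 0
  let f0 : ℝ → ConfE k := fun t => if t ∈ Icc 0 T then q t else q 0
  have h0T : (0:ℝ) ∈ Icc 0 T := ⟨le_rfl, hT⟩
  have hTT : T ∈ Icc 0 T := ⟨hT, le_rfl⟩
  have hf0 : ∀ t ∈ Icc 0 T, ∀ i, pt (f0 t) i = m i t := by
    intro t ht i
    simp only [f0, if_pos ht, hq]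
  have hmem : f0 ∈ SchedSet A B T R := by
    refine ⟨fun t => ?_, hT, fun i => ?_, fun i => ?_, fun i s hs t ht => ?_, fun t ht => ?_⟩
    · by_cases h : t ∈ Icc 0 T
      · simp only [f0, if_pos h]; exact hR (mem_image_of_mem _ h)
      · simp only [f0, if_neg h]; exact hR (mem_image_of_mem _ h0T)
    · simp only [hf0 0 h0T, hA]
    · simp only [hf0 T hTT, hB]
    · simp only [hf0 s hs, hf0 t ht]; exact hL i s hs t ht
    · simp only [hf0 t ht]; exact hF t ht
  obtain ⟨f, hf, hmin⟩ := LowerSemicontinuousOn.exists_isMinOn ⟨f0, hmem⟩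
    (schedSet_compact A B T R hT) ((variation_lsc (Icc 0 T)).lowerSemicontinuousOn _)
  refine ⟨T, le_rfl, fun i t => pt (f t) i, hf.2, fun i => ?_, fun σ => ?_⟩
  · have : LipschitzOnWith 1 (fun t => pt (f t) i) (Icc 0 T) := by
      refine LipschitzOnWith.of_dist_le_mul fun s hs t ht => ?_
      have h := hf.2.2.2.2.1 i s hs t ht
      simp only [l1, Prod.fst_sub, Prod.snd_sub] at h
      rw [NNReal.coe_one, one_mul, Prod.dist_eq, Real.dist_eq, Real.dist_eq, Real.dist_eq]
      refine max_le ?_ ?_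
      · linarith [abs_nonneg ((pt (f s) i).2 - (pt (f t) i).2)]
      · linarith [abs_nonneg ((pt (f s) i).1 - (pt (f t) i).1)]
    exact this.continuousOn
  · refine ⟨fun s hs t ht u hu => ?_⟩
    refine ⟨⟨hs.1.1.trans hu.1, hu.2.trans ht.1.2⟩, ?_⟩
    rcases (hu.1.trans hu.2).lt_or_eq with hst | hst
    · have hg := splice_mem hf hs.1.1 hst ht.1.2 hs.2 ht.2
      obtain ⟨c, hc, hcu⟩ := mem_segment_of_min hs.1.1 hst ht.1.2 hu (sched_finite hf.2)
        (isMinOn_iff.1 hmin _ hg)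
      show InOrdering σ (pt (f u))
      rw [← hcu]
      exact ord_convex hs.2 ht.2 hc
    · have : u = s := le_antisymm (hst ▸ hu.2) hu.1
      rw [this]; exact hs.2
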